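/- Let c₁, c₂, c₃, d, m be positive integers and suppose the polynomial t³ − c₁t² + c₂t − c₃ divides tᵐ − d in ℝ[t]. Then the positive real m-th root d^{1/m} of d is a root of t³ − c₁t² + c₂t − c₃. -/

import Mathlib

open Polynomial

/-- A monic real cubic with negative constant term has a positive root. -/
theorem exists_pos_root_cubic (a b c : ℝ) (hc : 0 < c) :
    ∃ t : ℝ, 0 < t ∧ t ^ 3 - a * t ^ 2 + b * t - c = 0 := by
  set T : ℝ := 1 + |a| + |b| + c
  have ha := abs_nonneg a
  have hb := abs_nonneg b
  have hT : 1 ≤ T := by simp only [T]; linarith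
  have hpos : 0 ≤ T ^ 3 - a * T ^ 2 + b * T - c := by
    have h1 : a * T ^ 2 ≤ |a| * T ^ 2 := by gcongr; exact le_abs_self a
    have h2 : -(|b| * T) ≤ b * T := by
      rw [← neg_mul]; gcongr; exact neg_abs_le b
    have h3 : |b| * T ≤ |b| * T ^ 2 := by gcongr; nlinarith
    have h4 : c ≤ c * T ^ 2 := by nlinarith [one_le_pow₀ (n := 2) hT]
    have h5 : T ^ 3 = (1 + |a| + |b| + c) * T ^ 2 := by simp only [T]; ring
    nlinarith [sq_nonneg T]
  have hcont : Continuous fun t : ℝ => t ^ 3 - a * t ^ 2 + b * t - c := by fun_prop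
  obtain ⟨t, ⟨ht, -⟩, hroot⟩ := intermediate_value_Icc (by linarith : (0 : ℝ) ≤ T)
    hcont.continuousOn (show (0 : ℝ) ∈ _ from ⟨by simp [hc.le], hpos⟩)
  refine ⟨t, ht.lt_of_ne ?_, hroot⟩
  rintro rfl
  norm_num at hroot
  exact hc.ne' hroot

/-- If `c₁, c₂, c₃, d, m` are positive integers and
`t³ − c₁t² + c₂t − c₃` divides `tᵐ − d` in `ℝ[t]`, then the positive real
`m`-th root `d^{1/m}` of `d` is a root of `t³ − c₁t² + c₂t − c₃`. -/
theorem stmt9 (c1 c2 c3 d : ℤ) (m : ℕ)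
    (hc1 : 0 < c1) (hc2 : 0 < c2) (hc3 : 0 < c3) (hd : 0 < d) (hm : 0 < m)
    (hdvd : (X ^ 3 - C (c1 : ℝ) * X ^ 2 + C (c2 : ℝ) * X - C (c3 : ℝ)) ∣
      (X ^ m - C (d : ℝ))) :
    ((d : ℝ) ^ ((1 : ℝ) / (m : ℝ))) ^ 3
      - (c1 : ℝ) * ((d : ℝ) ^ ((1 : ℝ) / (m : ℝ))) ^ 2
      + (c2 : ℝ) * ((d : ℝ) ^ ((1 : ℝ) / (m : ℝ)))
      - (c3 : ℝ) = 0 := by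
  obtain ⟨t, ht, hroot⟩ := exists_pos_root_cubic c1 c2 c3 (by exact_mod_cast hc3)
  have hpow : t ^ m = d := by
    have h := eval_dvd (x := t) hdvd
    simp only [eval_add, eval_sub, eval_mul, eval_pow, eval_X, eval_C, hroot,
      zero_dvd_iff] at h
    linarith
  have heq : (d : ℝ) ^ ((1 : ℝ) / (m : ℝ)) = t := by
    rw [← hpow, one_div, Real.pow_rpow_inv_natCast ht.le hm.ne']
  rw [heq, hroot]
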